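/- arXiv:2302.02313 — 2 statements merged into one kernel-verified Lean document; each statement's English description precedes it below -/
import Mathlib

section
/- In any strongly minimal Roman dominating function C, no player can strictly increase his utility by unilaterally increasing his value: for every vertex v_i and every c ∈ {0,1,2} with c > c_i, one has u_i(c, C_{−i}) < u_i(C). -/
open Finset

section Defs

variable {V : Type*} [Fintype V] [DecidableEq V] (G : SimpleGraph V) [DecidableRel G.Adj]

/-- The closed neighborhood `N̄ᵢ = Nᵢ ∪ {vᵢ}` of a vertex. -/
def closedNbhd (i : V) : Finset V := insert i (G.neighborFinset i)

/-- The graph has no isolated vertices. -/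
def noIsolated : Prop := ∀ v : V, ∃ u : V, G.Adj v u

/-- `m_j(C) = 1` if no vertex of `N̄_j` has value 2 under `C`, and `0` otherwise. -/
def mval (C : V → Fin 3) (j : V) : ℕ :=
  if ∀ k ∈ closedNbhd G j, C k ≠ 2 then 1 else 0

/-- The utility `u_i(C) = -λ1·c_i² - λ2·Σ_{j ∈ N̄ᵢ} (2 - c_j)·m_j(C)`. -/
def util (lam1 lam2 : ℝ) (C : V → Fin 3) (i : V) : ℝ :=
  -lam1 * ((C i : ℕ) : ℝ) ^ 2
    - lam2 * ∑ j ∈ closedNbhd G i, (2 - ((C j : ℕ) : ℝ)) * (mval G C j : ℝ)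

/-- The potential function `π(C) = -λ1·Σ_j c_j² - λ2·Σ_j (2 - c_j)·m_j(C)`. -/
def pot (lam1 lam2 : ℝ) (C : V → Fin 3) : ℝ :=
  -lam1 * ∑ j : V, ((C j : ℕ) : ℝ) ^ 2
    - lam2 * ∑ j : V, (2 - ((C j : ℕ) : ℝ)) * (mval G C j : ℝ)

/-- `C` is a Nash equilibrium: no unilateral deviation strictly improves a player's utility. -/
def isNE (lam1 lam2 : ℝ) (C : V → Fin 3) : Prop :=
  ∀ (i : V) (c : Fin 3),
    util G lam1 lam2 (Function.update C i c) i ≤ util G lam1 lam2 C i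

/-- `C` is a Roman dominating function. -/
def isRDF (C : V → Fin 3) : Prop :=
  ∀ v : V, C v = 0 → ∃ u : V, G.Adj v u ∧ C u = 2

/-- The weight `γ_R(G,C) = Σ_v C(v)`. -/
def weight (C : V → Fin 3) : ℕ := ∑ v : V, (C v : ℕ)

/-- Decrease a value in `{0,1,2}` by one (truncated at 0). -/
def decr (c : Fin 3) : Fin 3 := ⟨c.val - 1, lt_of_le_of_lt (Nat.sub_le _ _) c.isLt⟩

/-- `C` is a minimal RDF. -/
def isMRDF (C : V → Fin 3) : Prop :=
  isRDF G C ∧ ∀ i : V, 1 ≤ (C i : ℕ) → ¬ isRDF G (Function.update C i (decr (C i)))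

/-- `C` is a strongly minimal RDF. -/
def isSRDF (C : V → Fin 3) : Prop :=
  isMRDF G C ∧
    ¬ ∃ (C' : V → Fin 3) (i : V), isRDF G C' ∧ weight C' < weight C ∧
      C' i = 2 ∧ (∀ j : V, G.Adj i j → C j = 1 → C' j = 0) ∧
      (∀ k : V, k ≠ i → ¬(G.Adj i k ∧ C k = 1) → C' k = C k)

/-- `C` is a global minimum RDF. -/
def isGRDF (C : V → Fin 3) : Prop :=
  isRDF G C ∧ ∀ C' : V → Fin 3, isRDF G C' → weight C ≤ weight C'

/-- `Ñ_j(C)`: white neighbors of `v_j` for which `v_j` is the unique vertex of their closed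
neighborhood with value 2. -/
def tildeN (C : V → Fin 3) (j : V) : Finset V :=
  (G.neighborFinset j).filter
    (fun k => C k = 0 ∧ C j = 2 ∧ ∀ l ∈ closedNbhd G k, C l = 2 → l = j)

/-- `m_{i,j}(C) = 1` iff `Ñ_j(C) ⊆ N_i`. -/
def mij (C : V → Fin 3) (i j : V) : ℕ :=
  if tildeN G C j ⊆ G.neighborFinset i then 1 else 0

/-- `w_i(C) = Σ_{v_j ∈ N_i, c_j = 1} m_j(C) + 2·Σ_{v_j ∈ N_i, c_j = 2} m_{i,j}(C)`. -/
def wval (C : V → Fin 3) (i : V) : ℕ :=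
  ∑ j ∈ (G.neighborFinset i).filter (fun j => C j = 1), mval G C j
    + 2 * ∑ j ∈ (G.neighborFinset i).filter (fun j => C j = 2), mij G C i j

/-- The coalition `τ_i` of the private contract proposed by `v_i`. -/
def coalition (C : V → Fin 3) (i : V) : Finset V :=
  insert i ((G.neighborFinset i).filter
    (fun j => C j = 1 ∨ (C j = 2 ∧ mij G C i j = 1)))

/-- The contract profile: `v_i` takes value 2, the other coalition members take value 0. -/
def contract (C : V → Fin 3) (i : V) : V → Fin 3 :=
  fun k => if k = i then 2 else if k ∈ coalition G C i then 0 else C k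

end Defs

section

variable {V : Type*} [Fintype V] [DecidableEq V] {G : SimpleGraph V} [DecidableRel G.Adj]
  {C : V → Fin 3}

lemma mval_eq_zero_of_mem {j k : V} (hk : k ∈ closedNbhd G j) (h : C k = 2) :
    mval G C j = 0 :=
  if_neg fun H => H k hk h

lemma isRDF.mval_eq_zero (h : isRDF G C) {j : V} (hj : C j ≠ 1) : mval G C j = 0 := by
  have hc : C j = 0 ∨ C j = 2 := by revert hj; generalize C j = x; revert x; decide
  rcases hc with h0 | h2
  · obtain ⟨u, hu, hu2⟩ := h j h0
    exact mval_eq_zero_of_mem (by simp [closedNbhd, hu]) hu2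
  · exact mval_eq_zero_of_mem (by simp [closedNbhd]) h2

lemma mval_le_one (j : V) : mval G C j ≤ 1 := by
  unfold mval; split_ifs <;> simp

/-- Changing a value different from 2 into another value different from 2 changes no `m_j`. -/
lemma mval_update {i : V} {c : Fin 3} (hi : C i ≠ 2) (hc : c ≠ 2) (j : V) :
    mval G (Function.update C i c) j = mval G C j := by
  have h (k : V) : Function.update C i c k ≠ 2 ↔ C k ≠ 2 := by
    by_cases hk : k = i
    · subst hk; simp [hi, hc]
    · simp [hk]
  simp only [mval, h]

lemma two_sub_mul_mval_nonneg (j : V) : 0 ≤ (2 - ((C j : ℕ) : ℝ)) * (mval G C j : ℝ) := by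
  have h : ((C j : ℕ) : ℝ) ≤ 2 := by exact_mod_cast Nat.le_of_lt_succ (C j).isLt
  exact mul_nonneg (by linarith) (Nat.cast_nonneg _)

lemma isRDF.two_sub_mul_mval_le (h : isRDF G C) (j : V) :
    (2 - ((C j : ℕ) : ℝ)) * (mval G C j : ℝ) ≤ ((if C j = 1 then 1 else 0 : ℕ) : ℝ) := by
  by_cases hj : C j = 1
  · have hm : (mval G C j : ℝ) ≤ 1 := by exact_mod_cast mval_le_one j
    simp only [hj, if_true, Fin.val_one, Nat.cast_one]
    linarith
  · simp [hj, h.mval_eq_zero hj]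

/-- In a strongly minimal RDF, the value of a vertex of value less than 2 plus the number of its
neighbors of value 1 is at most 2. -/
lemma isSRDF.sum_ones_le (hS : isSRDF G C) {i : V} (hi : C i ≠ 2) :
    (C i : ℕ) + ∑ j ∈ G.neighborFinset i, (if C j = 1 then 1 else 0) ≤ 2 := by
  by_contra! hlt
  obtain ⟨⟨hR, -⟩, hmin⟩ := hS
  let C' : V → Fin 3 := fun k => if k = i then 2 else if G.Adj i k ∧ C k = 1 then 0 else C k
  refine hmin ⟨C', i, ?_, ?_, by simp [C'], ?_, ?_⟩
  · intro v hv
    have hvi : v ≠ i := by rintro rfl; simp [C'] at hv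
    by_cases ha : G.Adj i v
    · exact ⟨i, ha.symm, by simp [C']⟩
    · obtain ⟨u, hu, hu2⟩ := hR v (by simpa [C', hvi, ha] using hv)
      have hui : u ≠ i := by rintro rfl; exact hi hu2
      exact ⟨u, hu, by simp [C', hui, hu2]⟩
  · have key : ∑ k, ((C' k : ℕ) + ((if k = i then (C i : ℕ) else 0) +
        (if k ∈ G.neighborFinset i then (if C k = 1 then 1 else 0) else 0))) =
        ∑ k, ((C k : ℕ) + (if k = i then 2 else 0)) := by
      refine Finset.sum_congr rfl fun k _ => ?_
      by_cases hk : k = i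
      · subst hk; simp [C']; omega
      · by_cases ha : G.Adj i k <;> by_cases h1 : C k = 1 <;> simp [C', hk, ha, h1]
    simp only [Finset.sum_add_distrib, Finset.sum_ite_eq', Finset.mem_univ, if_true,
      Finset.sum_ite_mem, Finset.univ_inter] at key
    unfold weight
    omega
  · intro j hj h1
    simp [C', hj.ne', hj, h1]
  · intro k hk h
    simp only [C', hk, h, if_false]

end

/-- In any strongly minimal RDF C, no player can strictly increase his utility by
unilaterally increasing his value. -/
theorem stmt7 {V : Type*} [Fintype V] [DecidableEq V] (G : SimpleGraph V)
    [DecidableRel G.Adj] (lam1 lam2 : ℝ)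
    (h1 : 0 < 2 / 3 * lam2) (h2 : 2 / 3 * lam2 < lam1) (h3 : lam1 < 3 / 4 * lam2)
    (hiso : noIsolated G)
    (C : V → Fin 3) (hS : isSRDF G C) :
    ∀ (i : V) (c : Fin 3), C i < c →
      util G lam1 lam2 (Function.update C i c) i < util G lam1 lam2 C i := by
  have h0 : 0 < lam2 := by linarith
  intro i c hc
  have hR := hS.1.1
  have hi : C i ≠ 2 := by rintro h; rw [h] at hc; revert hc; revert c; decide
  by_cases hc2 : c = 2
  · subst hc2
    have hnew : 0 ≤ ∑ j ∈ closedNbhd G i, (2 - ((Function.update C i 2 j : ℕ) : ℝ)) *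
        (mval G (Function.update C i 2) j : ℝ) :=
      Finset.sum_nonneg fun j _ => two_sub_mul_mval_nonneg j
    have hold := Finset.sum_le_sum fun j (_ : j ∈ closedNbhd G i) => hR.two_sub_mul_mval_le j
    rw [← Nat.cast_sum] at hold
    have hbound : ∑ j ∈ closedNbhd G i, (if C j = 1 then 1 else 0) ≤ 2 := by
      rw [closedNbhd, Finset.sum_insert (by simp)]
      have hS' := hS.sum_ones_le hi
      by_cases h : C i = 1
      · simpa [h] using hS'
      · simp only [h, if_false]; omega
    have hbound' : ((∑ j ∈ closedNbhd G i, (if C j = 1 then 1 else 0) : ℕ) : ℝ) ≤ 2 := by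
      exact_mod_cast hbound
    have hsum := mul_le_mul_of_nonneg_left (hold.trans hbound') h0.le
    have hsum' := mul_nonneg h0.le hnew
    have hci : ((C i : ℕ) : ℝ) ≤ 1 := by
      have : (C i : ℕ) ≤ 1 := Nat.le_of_lt_succ hc
      exact_mod_cast this
    have hci0 : (0 : ℝ) ≤ ((C i : ℕ) : ℝ) := Nat.cast_nonneg _
    have hsq : lam1 * ((C i : ℕ) : ℝ) ^ 2 ≤ lam1 * 1 :=
      mul_le_mul_of_nonneg_left (pow_le_one₀ hci0 hci) (by linarith)
    have hval : ((Function.update C i 2 i : ℕ) : ℝ) = 2 := by simp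
    unfold util
    rw [hval]
    linarith
  · obtain ⟨hci, rfl⟩ : C i = 0 ∧ c = 1 := by
      revert hc hc2; generalize C i = x; revert x c; decide
    have hle : ∑ j ∈ closedNbhd G i, (2 - ((C j : ℕ) : ℝ)) * (mval G C j : ℝ) ≤
        ∑ j ∈ closedNbhd G i, (2 - ((Function.update C i 1 j : ℕ) : ℝ)) *
          (mval G (Function.update C i 1) j : ℝ) := by
      refine Finset.sum_le_sum fun j _ => ?_
      by_cases hj : j = i
      · subst hj
        rw [hR.mval_eq_zero (by simp [hci]), Nat.cast_zero, mul_zero]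
        exact two_sub_mul_mval_nonneg j
      · rw [mval_update hi hc2, Function.update_of_ne hj]
    have hle' := mul_le_mul_of_nonneg_left hle h0.le
    have hval : ((Function.update C i 1 i : ℕ) : ℝ) = 1 := by simp
    unfold util
    rw [hval, hci, Fin.val_zero, Nat.cast_zero]
    linarith
end

section
/- Any strictly improving synchronous play of the Roman domination game in which, at each round, a nonempty set of players with pairwise disjoint closed neighborhoods simultaneously make strictly improving changes, lasts at most (4λ1+2λ2)·n / min{3λ1−2λ2, −4λ1+3λ2} rounds. Precisely: if C^(0), …, C^(T) is a sequence of strategy profiles such that for each t < T there is a nonempty vertex set I_t with N̄_i ∩ N̄_j = ∅ for all distinct v_i, v_j ∈ I_t, C^(t+1) agrees with C^(t) outside I_t, and for every v_i ∈ I_t one has C^(t+1)(v_i) ≠ C^(t)(v_i) and u_i(C^(t+1)(v_i), C^(t)_{−i}) > u_i(C^(t)), then T ≤ (4λ1+2λ2)·n / min{3λ1−2λ2, −4λ1+3λ2}. -/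
open Finset

section Potential

variable {V : Type*} [Fintype V] [DecidableEq V] (G : SimpleGraph V) [DecidableRel G.Adj]

/-- The contribution of the vertex `j` to the potential function. -/
def localPot (lam1 lam2 : ℝ) (C : V → Fin 3) (j : V) : ℝ :=
  -lam1 * ((C j : ℕ) : ℝ) ^ 2 - lam2 * ((2 - ((C j : ℕ) : ℝ)) * (mval G C j : ℝ))

theorem pot_eq_sum_localPot (lam1 lam2 : ℝ) (C : V → Fin 3) :
    pot G lam1 lam2 C = ∑ j : V, localPot G lam1 lam2 C j := by
  simp only [pot, localPot, Finset.sum_sub_distrib, Finset.mul_sum]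

theorem mem_closedNbhd_self (i : V) : i ∈ closedNbhd G i :=
  Finset.mem_insert_self _ _

theorem mem_closedNbhd_comm {i j : V} : i ∈ closedNbhd G j ↔ j ∈ closedNbhd G i := by
  simp [closedNbhd, G.adj_comm, eq_comm]

theorem mval_congr {C D : V → Fin 3} {j : V} (h : ∀ k ∈ closedNbhd G j, C k = D k) :
    mval G C j = mval G D j := by
  have : (∀ k ∈ closedNbhd G j, C k ≠ 2) ↔ ∀ k ∈ closedNbhd G j, D k ≠ 2 :=
    forall₂_congr fun k hk => by rw [h k hk]
  simp only [mval, this]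

theorem localPot_congr (lam1 lam2 : ℝ) {C D : V → Fin 3} {j : V}
    (h : ∀ k ∈ closedNbhd G j, C k = D k) :
    localPot G lam1 lam2 C j = localPot G lam1 lam2 D j := by
  simp only [localPot, mval_congr G h, h j (mem_closedNbhd_self G j)]

theorem sum_localPot_update_sub (lam1 lam2 : ℝ) (C : V → Fin 3) (i : V) (c : Fin 3) :
    ∑ j ∈ closedNbhd G i,
        (localPot G lam1 lam2 (Function.update C i c) j - localPot G lam1 lam2 C j)
      = util G lam1 lam2 (Function.update C i c) i - util G lam1 lam2 C i := by
  have hsq : ∑ j ∈ closedNbhd G i,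
      (((Function.update C i c j : ℕ) : ℝ) ^ 2 - ((C j : ℕ) : ℝ) ^ 2)
        = ((Function.update C i c i : ℕ) : ℝ) ^ 2 - ((C i : ℕ) : ℝ) ^ 2 := by
    refine Finset.sum_eq_single i (fun j _ hj => ?_)
      (fun h => absurd (mem_closedNbhd_self G i) h)
    rw [Function.update_of_ne hj, sub_self]
  rw [Finset.sum_sub_distrib] at hsq
  simp only [localPot, util, Finset.sum_sub_distrib, ← Finset.mul_sum]
  linear_combination -lam1 * hsq

/-- When players with pairwise disjoint closed neighborhoods move simultaneously, the potential
changes by the sum of their individual changes of utility. -/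
theorem pot_sub_pot_eq_sum_util_sub (lam1 lam2 : ℝ) {C D : V → Fin 3} {I : Finset V}
    (hI : ∀ i ∈ I, ∀ j ∈ I, i ≠ j → Disjoint (closedNbhd G i) (closedNbhd G j))
    (hD : ∀ k : V, k ∉ I → D k = C k) :
    pot G lam1 lam2 D - pot G lam1 lam2 C
      = ∑ i ∈ I, (util G lam1 lam2 (Function.update C i (D i)) i - util G lam1 lam2 C i) := by
  have hsub : ∑ j ∈ I.biUnion (closedNbhd G),
      (localPot G lam1 lam2 D j - localPot G lam1 lam2 C j)
        = ∑ j : V, (localPot G lam1 lam2 D j - localPot G lam1 lam2 C j) := by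
    refine Finset.sum_subset (Finset.subset_univ _) fun j _ hj => ?_
    refine sub_eq_zero.2 (localPot_congr G _ _ fun k hk => hD k fun hkI => hj ?_)
    exact Finset.mem_biUnion.2 ⟨k, hkI, (mem_closedNbhd_comm G).1 hk⟩
  rw [pot_eq_sum_localPot, pot_eq_sum_localPot, ← Finset.sum_sub_distrib, ← hsub,
    Finset.sum_biUnion fun i hi j hj hij => hI i hi j hj hij]
  refine Finset.sum_congr rfl fun i hi => ?_
  rw [← sum_localPot_update_sub]
  refine Finset.sum_congr rfl fun j hj => ?_
  congr 1
  refine localPot_congr G _ _ fun k hk => ?_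
  by_cases hki : k = i
  · subst hki
    rw [Function.update_self]
  · rw [Function.update_of_ne hki]
    exact hD k fun hkI =>
      Finset.disjoint_left.1 (hI k hkI i hi hki) ((mem_closedNbhd_comm G).1 hk) hj

theorem pot_nonpos {lam1 lam2 : ℝ} (h1 : 0 ≤ lam1) (h2 : 0 ≤ lam2) (C : V → Fin 3) :
    pot G lam1 lam2 C ≤ 0 := by
  rw [pot_eq_sum_localPot]
  refine Finset.sum_nonpos fun j _ => ?_
  have hc : ((C j : ℕ) : ℝ) ≤ 2 := by exact_mod_cast Nat.le_of_lt_succ (C j).isLt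
  have := mul_nonneg h1 (sq_nonneg ((C j : ℕ) : ℝ))
  have := mul_nonneg h2 (mul_nonneg (sub_nonneg.2 hc) (Nat.cast_nonneg (α := ℝ) (mval G C j)))
  simp only [localPot]
  linarith

theorem le_pot {lam1 lam2 : ℝ} (h1 : 0 ≤ lam1) (h2 : 0 ≤ lam2) (C : V → Fin 3) :
    -((4 * lam1 + 2 * lam2) * Fintype.card V) ≤ pot G lam1 lam2 C := by
  have hj : ∀ j ∈ (Finset.univ : Finset V),
      -(4 * lam1 + 2 * lam2) ≤ localPot G lam1 lam2 C j := by
    intro j _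
    have hc : ((C j : ℕ) : ℝ) ≤ 2 := by exact_mod_cast Nat.le_of_lt_succ (C j).isLt
    have hc0 : (0 : ℝ) ≤ ((C j : ℕ) : ℝ) := Nat.cast_nonneg _
    have hm : (mval G C j : ℝ) ≤ 1 := by
      unfold mval
      split_ifs <;> simp
    have hm0 : (0 : ℝ) ≤ (mval G C j : ℝ) := Nat.cast_nonneg _
    have hsq : ((C j : ℕ) : ℝ) ^ 2 ≤ 4 := by nlinarith
    have hprod : (2 - ((C j : ℕ) : ℝ)) * (mval G C j : ℝ) ≤ 2 := by nlinarith
    have := mul_le_mul_of_nonneg_left hsq h1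
    have := mul_le_mul_of_nonneg_left hprod h2
    simp only [localPot]
    linarith
  have := Finset.card_nsmul_le_sum _ _ _ hj
  rw [nsmul_eq_mul, Finset.card_univ] at this
  rw [pot_eq_sum_localPot]
  linarith

theorem exists_util_eq_int (lam1 lam2 : ℝ) (C : V → Fin 3) (i : V) :
    ∃ K : ℤ, util G lam1 lam2 C i = -lam1 * ((C i : ℕ) : ℝ) ^ 2 - lam2 * K :=
  ⟨∑ j ∈ closedNbhd G i, (2 - ((C j : ℕ) : ℤ)) * (mval G C j : ℤ), by
    simp only [util]
    push_cast
    rfl⟩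

/-- A strictly improving move improves the utility by at least
`min (3λ1 - 2λ2) (-4λ1 + 3λ2)`. -/
theorem min_le_util_update_sub {lam1 lam2 : ℝ} (h1 : 0 < lam2) (h2 : 2 / 3 * lam2 < lam1)
    (h3 : lam1 < 3 / 4 * lam2) {C : V → Fin 3} {i : V} {c : Fin 3} (hc : c ≠ C i)
    (hlt : util G lam1 lam2 C i < util G lam1 lam2 (Function.update C i c) i) :
    min (3 * lam1 - 2 * lam2) (-4 * lam1 + 3 * lam2)
      ≤ util G lam1 lam2 (Function.update C i c) i - util G lam1 lam2 C i := by
  obtain ⟨K, hK⟩ := exists_util_eq_int G lam1 lam2 C i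
  obtain ⟨K', hK'⟩ := exists_util_eq_int G lam1 lam2 (Function.update C i c) i
  rw [Function.update_self] at hK'
  have hgap : ∀ m : ℤ, lam2 * (m - 1) < lam2 * ((K - K' : ℤ) : ℝ) →
      lam2 * m ≤ lam2 * ((K - K' : ℤ) : ℝ) := by
    intro m hm
    have hlt' : ((m - 1 : ℤ) : ℝ) < ((K - K' : ℤ) : ℝ) := by
      push_cast at hm ⊢
      exact lt_of_mul_lt_mul_left hm h1.le
    have hle : m ≤ K - K' := by
      have := Int.cast_lt.1 hlt'
      omega
    exact mul_le_mul_of_nonneg_left (Int.cast_le.2 hle) h1.le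
  rw [hK, hK'] at hlt ⊢
  push_cast at hgap
  generalize C i = d at *
  rw [min_le_iff]
  fin_cases c <;> fin_cases d <;> try exact absurd rfl hc
  all_goals norm_num at hlt ⊢
  · have := hgap 0 (by push_cast; linarith)
    push_cast at this
    left; linarith
  · have := hgap (-2) (by push_cast; linarith)
    push_cast at this
    left; linarith
  · have := hgap 1 (by push_cast; linarith)
    push_cast at this
    right; linarith
  · have := hgap (-2) (by push_cast; linarith)
    push_cast at this
    left; linarith
  · have := hgap 3 (by push_cast; linarith)
    push_cast at this
    right; linarith
  · have := hgap 3 (by push_cast; linarith)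
    push_cast at this
    right; linarith

end Potential

/-- Any strictly improving synchronous play, in which at each round a nonempty
set of players with pairwise disjoint closed neighborhoods simultaneously make strictly
improving changes, lasts at most (4λ1+2λ2)·n / min{3λ1−2λ2, −4λ1+3λ2} rounds. -/
theorem stmt14 {V : Type*} [Fintype V] [DecidableEq V] (G : SimpleGraph V)
    [DecidableRel G.Adj] (lam1 lam2 : ℝ)
    (h1 : 0 < 2 / 3 * lam2) (h2 : 2 / 3 * lam2 < lam1) (h3 : lam1 < 3 / 4 * lam2)
    (hiso : noIsolated G)
    (T : ℕ) (Cs : ℕ → V → Fin 3)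
    (hstep : ∀ t < T, ∃ I : Finset V, I.Nonempty ∧
      (∀ i ∈ I, ∀ j ∈ I, i ≠ j → Disjoint (closedNbhd G i) (closedNbhd G j)) ∧
      (∀ k : V, k ∉ I → Cs (t + 1) k = Cs t k) ∧
      (∀ i ∈ I, Cs (t + 1) i ≠ Cs t i ∧
        util G lam1 lam2 (Cs t) i
          < util G lam1 lam2 (Function.update (Cs t) i (Cs (t + 1) i)) i)) :
    (T : ℝ) ≤ (4 * lam1 + 2 * lam2) * (Fintype.card V)
      / min (3 * lam1 - 2 * lam2) (-4 * lam1 + 3 * lam2) := by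
  have hlam2 : 0 < lam2 := by linarith
  have hlam1 : 0 < lam1 := by linarith
  have hgrow : ∀ t ≤ T, pot G lam1 lam2 (Cs 0)
      + t * min (3 * lam1 - 2 * lam2) (-4 * lam1 + 3 * lam2) ≤ pot G lam1 lam2 (Cs t) := by
    intro t
    induction t with
    | zero => simp
    | succ t ih =>
      intro ht
      obtain ⟨I, ⟨i, hi⟩, hdisj, hfix, himp⟩ := hstep t ht
      have hdiff := pot_sub_pot_eq_sum_util_sub G lam1 lam2 hdisj hfix
      have hsingle := Finset.single_le_sum
        (f := fun i => util G lam1 lam2 (Function.update (Cs t) i (Cs (t + 1) i)) i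
          - util G lam1 lam2 (Cs t) i)
        (fun j hj => sub_nonneg.2 (himp j hj).2.le) hi
      have hmin := min_le_util_update_sub G hlam2 h2 h3 (himp i hi).1 (himp i hi).2
      have := ih (Nat.le_of_succ_le ht)
      push_cast
      linarith
  rw [le_div_iff₀ (lt_min (by linarith) (by linarith))]
  have := hgrow T le_rfl
  have := pot_nonpos G hlam1.le hlam2.le (Cs T)
  have := le_pot G hlam1.le hlam2.le (Cs 0)
  linarith
end
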